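/- arXiv:2511.00986 — 10 statements merged into one kernel-verified Lean document; each statement's English description precedes it below -/
import Mathlib

section
/- Fix λ* = (3−√3)/2 and w* = √3−1. Let V be a finite nonempty set of voters and let A, B, C be three candidates, all points of a pseudometric space (M,d). Fix a tie-consistent partition (AC, CA) of V for the pair (A,C) and a tie-consistent partition (CB, BC) of V for the pair (C,B), a maximum matching between AC and CA and a maximum matching between CB and BC, and tie-consistent deliberation assignments for both matchings, yielding win counts W_AC, W_CA, W_CB, W_BC. If f(AC;w*) ≥ 1−λ* and f(CB;w*) ≥ λ*, then SC(A) ≤ 3·SC(B). (This is the core quantitative content of the paper's Main Theorem: the deliberation-via-matching protocol with the λ*-weighted uncovered set rule has metric distortion at most 3.) -/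
open Finset

/-- If `g ≤ 0` on `P`, `g ≤ k` on `Q`, and `M` matches `P` into `Q` so that `g` sums to at most `0`
over every pair with `win p = true`, then only the remaining pairs and the unmatched voters of `Q`
can contribute positively to `∑ v, g v`. -/
theorem sum_le_of_matching {V : Type*} [Fintype V] [DecidableEq V] (P Q : Finset V)
    (hdisj : Disjoint P Q) (hunion : P ∪ Q = Finset.univ) (M : Finset (V × V))
    (hmem : ∀ p ∈ M, p.1 ∈ P ∧ p.2 ∈ Q)
    (hinj : ∀ p ∈ M, ∀ q ∈ M, (p.1 = q.1 ∨ p.2 = q.2) → p = q)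
    (win : V × V → Bool) (g : V → ℝ) (k : ℝ)
    (hP : ∀ v ∈ P, g v ≤ 0) (hQ : ∀ v ∈ Q, g v ≤ k)
    (hwin : ∀ p ∈ M, win p = true → g p.1 + g p.2 ≤ 0) :
    ∑ v, g v ≤ k * ((M.filter fun p => win p = false).card + (Q.card - M.card)) := by
  have inj_fst : Set.InjOn Prod.fst (M : Set (V × V)) :=
    fun p hp q hq h => hinj p hp q hq (Or.inl h)
  have inj_snd : Set.InjOn Prod.snd (M : Set (V × V)) :=
    fun p hp q hq h => hinj p hp q hq (Or.inr h)
  have sub_fst : M.image Prod.fst ⊆ P := Finset.image_subset_iff.2 fun p hp => (hmem p hp).1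
  have sub_snd : M.image Prod.snd ⊆ Q := Finset.image_subset_iff.2 fun p hp => (hmem p hp).2
  have sumP : ∑ v ∈ P, g v ≤ ∑ p ∈ M, g p.1 := by
    rw [← Finset.sum_image (f := g) inj_fst, ← Finset.sum_sdiff sub_fst]
    have := Finset.sum_nonpos fun v (hv : v ∈ P \ M.image Prod.fst) =>
      hP v (Finset.mem_sdiff.1 hv).1
    linarith
  have sumQ : ∑ v ∈ Q, g v ≤ ∑ p ∈ M, g p.2 + k * (Q.card - M.card) := by
    rw [← Finset.sum_image (f := g) inj_snd, ← Finset.sum_sdiff sub_snd]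
    have h := Finset.sum_le_card_nsmul (Q \ M.image Prod.snd) g k
      fun v hv => hQ v (Finset.mem_sdiff.1 hv).1
    rw [nsmul_eq_mul, Finset.cast_card_sdiff sub_snd, Finset.card_image_of_injOn inj_snd] at h
    linarith
  have sumM : ∑ p ∈ M, (g p.1 + g p.2) ≤ k * (M.filter fun p => win p = false).card := by
    rw [Finset.card_filter, Nat.cast_sum, Finset.mul_sum]
    refine Finset.sum_le_sum fun p hp => ?_
    cases h : win p
    · have := hP _ (hmem p hp).1
      have := hQ _ (hmem p hp).2
      simp
      linarith
    · simpa using hwin p hp h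
  rw [← hunion, Finset.sum_union hdisj]
  rw [Finset.sum_add_distrib] at sumM
  linarith

theorem clamp_add_clamp_nonpos {m s t : ℝ} (hm : 0 ≤ m) (h : s + t ≤ 0) :
    max (-m) (min m s) + max (-m) (min m t) ≤ 0 := by
  rcases max_cases (-m) (min m s) with h₁ | h₁ <;> rcases max_cases (-m) (min m t) with h₂ | h₂ <;>
  rcases min_cases m s with h₃ | h₃ <;> rcases min_cases m t with h₄ | h₄ <;> linarith

/-- The pointwise inequality behind distortion `3`: here `a`, `b`, `c` are the distances of a voter
to three candidates whose mutual distances are `x = d(A,B)`, `y = d(C,B)`, `z = d(A,C)`. -/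
theorem pointwise_bound {a b c x y z m s : ℝ} (hb : 0 ≤ b) (hm : m = max 0 (min x z - y / 2))
    (hx : x ≤ a + b) (ha : a ≤ x + b) (hy : y ≤ b + c) (hc : c ≤ y + b) (hbc : b ≤ y + c)
    (hz : z ≤ a + c) (hca : c ≤ z + a) (hac : a ≤ z + c)
    (hs : s = -(y / 2) ∧ c ≤ b ∨ s = y / 2 ∧ b ≤ c) :
    a - 3 * b ≤ (2 * max (-m) (min m (a - c)) - m) + ((c - b) + s) := by
  subst hm
  rcases hs with ⟨rfl, hs⟩ | ⟨rfl, hs⟩ <;>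
  rcases max_cases 0 (min x z - y / 2) with ⟨h₁, h₂⟩ | ⟨h₁, h₂⟩ <;> rw [h₁] <;>
  rcases min_cases x z with ⟨h₃, h₄⟩ | ⟨h₃, h₄⟩ <;> rw [h₃] at h₂ <;> (try rw [h₃]) <;>
  (try simp only [neg_zero]) <;>
  first
  | (rcases max_cases 0 (min 0 (a - c)) with h₅ | h₅ <;>
      rcases min_cases 0 (a - c) with h₆ | h₆ <;> linarith)
  | (rcases max_cases (-(x - y / 2)) (min (x - y / 2) (a - c)) with h₅ | h₅ <;>
      rcases min_cases (x - y / 2) (a - c) with h₆ | h₆ <;> linarith)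
  | (rcases max_cases (-(z - y / 2)) (min (z - y / 2) (a - c)) with h₅ | h₅ <;>
      rcases min_cases (z - y / 2) (a - c) with h₆ | h₆ <;> linarith)

/-- A score share of at least `w / 2` with `w = √3 - 1` bounds the losing pairs and unmatched
opponents by half of the voters. -/
theorem two_mul_le_of_score {w P Q M W L : ℝ} (hw : w ^ 2 = 2 - 2 * w) (hw₀ : 0 < w)
    (hW : 0 ≤ W) (hM : M = min P Q) (hWL : W + L = M)
    (h : w / 2 * ((P + w * W) + (Q + w * L)) ≤ P + w * W) :
    2 * (L + (Q - M)) ≤ P + Q := by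
  rcases min_cases P Q with ⟨h₁, h₂⟩ | ⟨h₁, h₂⟩
  · have hL : L = P - W := by linarith
    subst hL
    have : w * (P + Q) ≤ w * (2 * P + 2 * W) := by
      linear_combination 2 * h - P * hw
    have := le_of_mul_le_mul_left this hw₀
    linarith
  · linarith

/-- A score share of at least `1 - w / 2` with `w = √3 - 1` bounds the losing pairs and unmatched
opponents by half of the winning margin. -/
theorem two_mul_le_margin_of_score {w P Q M W L : ℝ} (hw : w ^ 2 = 2 - 2 * w) (hw₀ : 0 < w)
    (hw₁ : w < 1) (hL₀ : 0 ≤ L) (hM : M = min P Q) (hWL : W + L = M)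
    (h : (1 - w / 2) * ((P + w * W) + (Q + w * L)) ≤ P + w * W) :
    2 * (L + (Q - M)) ≤ P - Q := by
  have hWe : W = M - L := by linarith
  subst hWe
  rcases min_cases P Q with ⟨h₁, h₂⟩ | ⟨h₁, h₂⟩
  · rw [hM, h₁] at h ⊢
    have h₃ : (2 - w) * (Q - P) + 2 * w * L ≤ 0 := by linear_combination 2 * h + P * hw
    have h₄ : 0 ≤ (2 - w) * (Q - P) := mul_nonneg (by linarith) (by linarith)
    have h₅ : L ≤ 0 := by nlinarith
    have h₆ : Q - P ≤ 0 := by nlinarith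
    linarith
  · rw [hM, h₁] at h ⊢
    have : w * (2 * L) ≤ w * (P - Q) := by linear_combination 2 * h + Q * hw
    have := le_of_mul_le_mul_left this hw₀
    linarith

/-- **Deliberation via matching, main theorem (distortion ≤ 3).**
With `λ* = (3−√3)/2` and `w* = √3−1`, for any pseudometric instance with candidates
`A, B, C`, tie-consistent partitions `(AC, CA)` and `(CB, BC)`, arbitrary maximum
matchings with tie-consistent deliberation assignments, if `f(AC; w*) ≥ 1 − λ*` and
`f(CB; w*) ≥ λ*`, then `SC(A) ≤ 3 · SC(B)`. -/
theorem deliberation_via_matching_distortion_three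
    {M : Type*} [PseudoMetricSpace M] {V : Type*} [Fintype V] [DecidableEq V]
    [Nonempty V]
    (A B C : M) (ι : V → M)
    (lam w : ℝ) (hlam : lam = (3 - Real.sqrt 3) / 2) (hw : w = Real.sqrt 3 - 1)
    -- tie-consistent partition (AC, CA) for the pair (A, C)
    (AC CA : Finset V)
    (hACdisj : Disjoint AC CA) (hACunion : AC ∪ CA = Finset.univ)
    (hAC : ∀ v ∈ AC, dist (ι v) A ≤ dist (ι v) C)
    (hCA : ∀ v ∈ CA, dist (ι v) C ≤ dist (ι v) A)
    -- tie-consistent partition (CB, BC) for the pair (C, B)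
    (CB BC : Finset V)
    (hCBdisj : Disjoint CB BC) (hCBunion : CB ∪ BC = Finset.univ)
    (hCB : ∀ v ∈ CB, dist (ι v) C ≤ dist (ι v) B)
    (hBC : ∀ v ∈ BC, dist (ι v) B ≤ dist (ι v) C)
    -- a maximum matching between AC and CA
    (M₁ : Finset (V × V))
    (hM₁mem : ∀ p ∈ M₁, p.1 ∈ AC ∧ p.2 ∈ CA)
    (hM₁inj : ∀ p ∈ M₁, ∀ q ∈ M₁, (p.1 = q.1 ∨ p.2 = q.2) → p = q)
    (hM₁max : M₁.card = min AC.card CA.card)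
    -- a maximum matching between CB and BC
    (M₂ : Finset (V × V))
    (hM₂mem : ∀ p ∈ M₂, p.1 ∈ CB ∧ p.2 ∈ BC)
    (hM₂inj : ∀ p ∈ M₂, ∀ q ∈ M₂, (p.1 = q.1 ∨ p.2 = q.2) → p = q)
    (hM₂max : M₂.card = min CB.card BC.card)
    -- tie-consistent deliberation assignments (`true` = first candidate wins)
    (win₁ : V × V → Bool)
    (hwin₁ : ∀ p ∈ M₁,
      (win₁ p = true →
        dist (ι p.1) A + dist (ι p.2) A ≤ dist (ι p.1) C + dist (ι p.2) C) ∧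
      (win₁ p = false →
        dist (ι p.1) C + dist (ι p.2) C ≤ dist (ι p.1) A + dist (ι p.2) A))
    (win₂ : V × V → Bool)
    (hwin₂ : ∀ p ∈ M₂,
      (win₂ p = true →
        dist (ι p.1) C + dist (ι p.2) C ≤ dist (ι p.1) B + dist (ι p.2) B) ∧
      (win₂ p = false →
        dist (ι p.1) B + dist (ι p.2) B ≤ dist (ι p.1) C + dist (ι p.2) C))
    -- win counts
    (WAC WCA WCB WBC : ℕ)
    (hWAC : WAC = (M₁.filter fun p => win₁ p = true).card)
    (hWCA : WCA = (M₁.filter fun p => win₁ p = false).card)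
    (hWCB : WCB = (M₂.filter fun p => win₂ p = true).card)
    (hWBC : WBC = (M₂.filter fun p => win₂ p = false).card)
    -- the weighted uncovered set conditions f(AC; w*) ≥ 1 − λ* and f(CB; w*) ≥ λ*
    (hfAC : ((AC.card : ℝ) + w * WAC) /
        (((AC.card : ℝ) + w * WAC) + ((CA.card : ℝ) + w * WCA)) ≥ 1 - lam)
    (hfCB : ((CB.card : ℝ) + w * WCB) /
        (((CB.card : ℝ) + w * WCB) + ((BC.card : ℝ) + w * WBC)) ≥ lam) :
    (∑ v, dist (ι v) A) ≤ 3 * ∑ v, dist (ι v) B := by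
  have h3 : Real.sqrt 3 ^ 2 = 3 := Real.sq_sqrt (by norm_num)
  have h3₀ : 0 ≤ Real.sqrt 3 := Real.sqrt_nonneg 3
  have hw2 : w ^ 2 = 2 - 2 * w := by rw [hw]; linarith
  have hw₀ : 0 < w := by rw [hw]; nlinarith
  have hw₁ : w < 1 := by rw [hw]; nlinarith
  obtain rfl : lam = 1 - w / 2 := by rw [hlam, hw]; ring
  have card₁ : (AC.card : ℝ) + CA.card = Fintype.card V := by
    rw [← Finset.card_univ, ← hACunion, Finset.card_union_of_disjoint hACdisj, Nat.cast_add]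
  have card₂ : (CB.card : ℝ) + BC.card = Fintype.card V := by
    rw [← Finset.card_univ, ← hCBunion, Finset.card_union_of_disjoint hCBdisj, Nat.cast_add]
  have hn : (0 : ℝ) < Fintype.card V := by exact_mod_cast Fintype.card_pos
  have hM₁ : (WAC : ℝ) + WCA = M₁.card := by
    have := M₁.card_filter_add_card_filter_not fun p => win₁ p = true
    simp only [Bool.not_eq_true] at this
    rw [hWAC, hWCA]
    exact_mod_cast this
  have hM₂ : (WCB : ℝ) + WBC = M₂.card := by
    have := M₂.card_filter_add_card_filter_not fun p => win₂ p = true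
    simp only [Bool.not_eq_true] at this
    rw [hWCB, hWBC]
    exact_mod_cast this
  have score₁ : 2 * ((WCA : ℝ) + (CA.card - M₁.card)) ≤ AC.card + CA.card := by
    have pos : 0 < ((AC.card : ℝ) + w * WAC) + ((CA.card : ℝ) + w * WCA) := by
      have : 0 ≤ w * WAC := by positivity
      have : 0 ≤ w * WCA := by positivity
      linarith
    rw [ge_iff_le, le_div_iff₀ pos, sub_sub_cancel] at hfAC
    exact two_mul_le_of_score hw2 hw₀ (Nat.cast_nonneg WAC) (by rw [hM₁max, Nat.cast_min]) hM₁ hfAC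
  have score₂ : 2 * ((WBC : ℝ) + (BC.card - M₂.card)) ≤ CB.card - BC.card := by
    have pos : 0 < ((CB.card : ℝ) + w * WCB) + ((BC.card : ℝ) + w * WBC) := by
      have : 0 ≤ w * WCB := by positivity
      have : 0 ≤ w * WBC := by positivity
      linarith
    rw [ge_iff_le, le_div_iff₀ pos] at hfCB
    exact two_mul_le_margin_of_score hw2 hw₀ hw₁ (Nat.cast_nonneg WBC)
      (by rw [hM₂max, Nat.cast_min]) hM₂ hfCB
  obtain ⟨m, hm⟩ : ∃ m, m = max 0 (min (dist A B) (dist A C) - dist C B / 2) := ⟨_, rfl⟩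
  have hm₀ : 0 ≤ m := hm ▸ le_max_left _ _
  have sum₁ := sum_le_of_matching AC CA hACdisj hACunion M₁ hM₁mem hM₁inj win₁
    (fun v => max (-m) (min m (dist (ι v) A - dist (ι v) C))) m
    (fun v hv => max_le (by linarith) ((min_le_right _ _).trans (by linarith [hAC v hv])))
    (fun v _ => max_le (by linarith) (min_le_left _ _))
    (fun p hp h => clamp_add_clamp_nonpos hm₀ (by linarith [(hwin₁ p hp).1 h]))
  have sum₂ := sum_le_of_matching CB BC hCBdisj hCBunion M₂ hM₂mem hM₂inj win₂
    (fun v => dist (ι v) C - dist (ι v) B) (dist C B)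
    (fun v hv => by linarith [hCB v hv])
    (fun v _ => by linarith [dist_triangle (ι v) B C, dist_comm B C])
    (fun p hp h => by linarith [(hwin₂ p hp).1 h])
  rw [← hWCA] at sum₁
  rw [← hWBC] at sum₂
  have sign_sum : ∑ v, (if v ∈ CB then -(dist C B / 2) else dist C B / 2) =
      dist C B / 2 * (BC.card - CB.card) := by
    have hCBn : ∀ v ∈ BC, v ∉ CB := fun v hv h => Finset.disjoint_left.1 hCBdisj h hv
    rw [← hCBunion, Finset.sum_union hCBdisj, Finset.sum_ite_of_true fun v hv => hv,
      Finset.sum_ite_of_false hCBn]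
    simp only [Finset.sum_const, nsmul_eq_mul]
    ring
  have pointwise : ∀ v, dist (ι v) A - 3 * dist (ι v) B ≤
      (2 * max (-m) (min m (dist (ι v) A - dist (ι v) C)) - m) +
      ((dist (ι v) C - dist (ι v) B) + if v ∈ CB then -(dist C B / 2) else dist C B / 2) := by
    intro v
    refine pointwise_bound dist_nonneg hm (dist_triangle_left _ _ _) ?_ ?_ ?_ ?_
      (dist_triangle_left _ _ _) ?_ ?_ ?_
    · linarith [dist_triangle (ι v) B A, dist_comm A B]
    · linarith [dist_triangle_left C B (ι v)]
    · linarith [dist_triangle (ι v) B C, dist_comm B C]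
    · linarith [dist_triangle (ι v) C B]
    · linarith [dist_triangle (ι v) A C]
    · linarith [dist_triangle (ι v) C A, dist_comm A C]
    · by_cases h : v ∈ CB
      · exact Or.inl ⟨if_pos h, hCB v h⟩
      · have : v ∈ CB ∪ BC := hCBunion ▸ Finset.mem_univ v
        exact Or.inr ⟨if_neg h, hBC v ((Finset.mem_union.1 this).resolve_left h)⟩
  have total := Finset.sum_le_sum fun v (_ : v ∈ Finset.univ) => pointwise v
  rw [Finset.sum_add_distrib, Finset.sum_sub_distrib, Finset.sum_sub_distrib,
    Finset.sum_add_distrib, ← Finset.mul_sum, ← Finset.mul_sum, sign_sum, Finset.sum_const,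
    Finset.card_univ, nsmul_eq_mul, ← card₁] at total
  have bound₁ := mul_le_mul_of_nonneg_left score₁ hm₀
  have bound₂ := mul_le_mul_of_nonneg_left score₂ (dist_nonneg (x := C) (y := B))
  linarith
end

section
/- Let V be a finite nonempty set of voters and let A, B be two candidates, all points of a pseudometric space (M,d). Fix a tie-consistent partition (AB, BA) of V, a maximum matching M between AB and BA, and a tie-consistent deliberation assignment for M, giving W_A matched pairs won by A and W_B = |M| − W_A matched pairs won by B. If |AB| + W_A ≥ |BA| + W_B, then SC(A) ≤ 2·SC(B). (Theorem: the deliberation-via-matching protocol with the Copeland rule has metric distortion at most 2 on any 2-candidate instance.) -/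
open Finset

/-- Reindexing along a map injective on `s` does not increase a sum of nonnegative terms. -/
lemma sum_le_sum_of_injOn {α β : Type*} {s : Finset α} {t : Finset β} (f : β → ℝ)
    (g : α → β) (hg : ∀ a ∈ s, g a ∈ t) (hinj : ∀ a ∈ s, ∀ b ∈ s, g a = g b → a = b)
    (hf : ∀ b ∈ t, 0 ≤ f b) : ∑ a ∈ s, f (g a) ≤ ∑ b ∈ t, f b := by
  classical
  rw [← Finset.sum_image (f := f) (g := g) fun a ha b hb => hinj a ha b hb]
  exact Finset.sum_le_sum_of_subset_of_nonneg (Finset.image_subset_iff.2 hg)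
    fun b hb _ => hf b hb

/-- **Deliberation via matching with the Copeland rule has distortion at most 2
on two-candidate instances.** If `|AB| + W_A ≥ |BA| + W_B` (A wins the weighted
majority after deliberation), then `SC(A) ≤ 2 · SC(B)`. -/
theorem deliberation_two_candidates_distortion_two
    {M : Type*} [PseudoMetricSpace M] {V : Type*} [Fintype V] [DecidableEq V]
    [Nonempty V]
    (A B : M) (ι : V → M)
    -- tie-consistent partition (AB, BA)
    (AB BA : Finset V)
    (hdisj : Disjoint AB BA) (hunion : AB ∪ BA = Finset.univ)
    (hAB : ∀ v ∈ AB, dist (ι v) A ≤ dist (ι v) B)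
    (hBA : ∀ v ∈ BA, dist (ι v) B ≤ dist (ι v) A)
    -- a maximum matching between AB and BA
    (Mm : Finset (V × V))
    (hMmem : ∀ p ∈ Mm, p.1 ∈ AB ∧ p.2 ∈ BA)
    (hMinj : ∀ p ∈ Mm, ∀ q ∈ Mm, (p.1 = q.1 ∨ p.2 = q.2) → p = q)
    (hMmax : Mm.card = min AB.card BA.card)
    -- tie-consistent deliberation assignment (`true` = A wins)
    (win : V × V → Bool)
    (hwin : ∀ p ∈ Mm,
      (win p = true →
        dist (ι p.1) A + dist (ι p.2) A ≤ dist (ι p.1) B + dist (ι p.2) B) ∧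
      (win p = false →
        dist (ι p.1) B + dist (ι p.2) B ≤ dist (ι p.1) A + dist (ι p.2) A))
    -- win counts
    (WA WB : ℕ)
    (hWA : WA = (Mm.filter fun p => win p = true).card)
    (hWB : WB = (Mm.filter fun p => win p = false).card)
    -- A wins under the Copeland rule with deliberation weight 1
    (hwinner : AB.card + WA ≥ BA.card + WB) :
    (∑ v, dist (ι v) A) ≤ 2 * ∑ v, dist (ι v) B := by
  set D := dist A B
  have hD0 : 0 ≤ D := dist_nonneg
  have htri : ∀ v, D ≤ dist (ι v) A + dist (ι v) B := fun v => dist_triangle_left A B (ι v)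
  have htri' : ∀ v, dist (ι v) A ≤ dist (ι v) B + D := fun v => by
    have := dist_triangle (ι v) B A
    rwa [dist_comm B A] at this
  have hcount : 2 * BA.card ≤ AB.card + 3 * WA := by
    have hsplit := Finset.card_filter_add_card_filter_not (s := Mm) (fun p => win p = true)
    simp only [Bool.not_eq_true] at hsplit
    omega
  have hcount' : 2 * (BA.card : ℝ) ≤ AB.card + 3 * WA := by exact_mod_cast hcount
  have hleft : ∑ p ∈ Mm, (2 * dist (ι p.1) B - dist (ι p.1) A - D / 2)
      ≤ ∑ v ∈ AB, (2 * dist (ι v) B - dist (ι v) A - D / 2) := by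
    refine sum_le_sum_of_injOn
      (fun v => 2 * dist (ι v) B - dist (ι v) A - D / 2) Prod.fst (fun p hp => (hMmem p hp).1)
      (fun p hp q hq h => hMinj p hp q hq (Or.inl h)) fun v hv => ?_
    linarith [hAB v hv, htri v]
  have hright : ∑ p ∈ Mm, (2 * dist (ι p.2) B - dist (ι p.2) A + D)
      ≤ ∑ v ∈ BA, (2 * dist (ι v) B - dist (ι v) A + D) := by
    refine sum_le_sum_of_injOn
      (fun v => 2 * dist (ι v) B - dist (ι v) A + D) Prod.snd (fun p hp => (hMmem p hp).2)
      (fun p hp q hq h => hMinj p hp q hq (Or.inr h)) fun v _ => ?_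
    linarith [htri' v, dist_nonneg (x := ι v) (y := B)]
  have hpairs : (WA : ℝ) * (3 / 2 * D) ≤ ∑ p ∈ Mm,
      ((2 * dist (ι p.1) B - dist (ι p.1) A - D / 2)
        + (2 * dist (ι p.2) B - dist (ι p.2) A + D)) := by
    rw [hWA, ← nsmul_eq_mul, ← Finset.sum_const, Finset.sum_filter]
    refine Finset.sum_le_sum fun p hp => ?_
    have h1 := htri p.1
    have h2 := htri p.2
    split_ifs with hw
    · linarith [(hwin p hp).1 hw]
    · linarith [hAB p.1 (hMmem p hp).1, htri' p.2, dist_nonneg (x := ι p.2) (y := B)]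
  have htotal : ∑ v, (2 * dist (ι v) B - dist (ι v) A)
      = ∑ v ∈ AB, (2 * dist (ι v) B - dist (ι v) A)
        + ∑ v ∈ BA, (2 * dist (ι v) B - dist (ι v) A) := by
    rw [← hunion, Finset.sum_union hdisj]
  rw [Finset.sum_add_distrib] at hpairs
  rw [Finset.sum_sub_distrib _ (fun _ => D / 2) (s := AB), Finset.sum_const, nsmul_eq_mul] at hleft
  rw [Finset.sum_add_distrib (s := BA), Finset.sum_const, nsmul_eq_mul] at hright
  rw [Finset.sum_sub_distrib (s := Finset.univ), ← Finset.mul_sum] at htotal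
  linarith [mul_le_mul_of_nonneg_right hcount' hD0]
end

section
/- Let V be a finite nonempty set of voters and let A, B be two candidates, all points of a pseudometric space (M,d). Fix a tie-consistent partition (AB, BA) of V, a maximum matching M between AB and BA, and a tie-consistent deliberation assignment for M, giving W_A matched pairs won by A. Then SC(A) ≤ SC(B) + (|BA| − W_A)·d(A,B). -/
open Finset

/-- **Upper bound on SC(A):** `SC(A) ≤ SC(B) + (|BA| − W_A) · d(A,B)`. -/
theorem sc_A_upper_bound
    {M : Type*} [PseudoMetricSpace M] {V : Type*} [Fintype V] [DecidableEq V]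
    [Nonempty V]
    (A B : M) (ι : V → M)
    -- tie-consistent partition (AB, BA)
    (AB BA : Finset V)
    (hdisj : Disjoint AB BA) (hunion : AB ∪ BA = Finset.univ)
    (hAB : ∀ v ∈ AB, dist (ι v) A ≤ dist (ι v) B)
    (hBA : ∀ v ∈ BA, dist (ι v) B ≤ dist (ι v) A)
    -- a maximum matching between AB and BA
    (Mm : Finset (V × V))
    (hMmem : ∀ p ∈ Mm, p.1 ∈ AB ∧ p.2 ∈ BA)
    (hMinj : ∀ p ∈ Mm, ∀ q ∈ Mm, (p.1 = q.1 ∨ p.2 = q.2) → p = q)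
    (hMmax : Mm.card = min AB.card BA.card)
    -- tie-consistent deliberation assignment (`true` = A wins)
    (win : V × V → Bool)
    (hwin : ∀ p ∈ Mm,
      (win p = true →
        dist (ι p.1) A + dist (ι p.2) A ≤ dist (ι p.1) B + dist (ι p.2) B) ∧
      (win p = false →
        dist (ι p.1) B + dist (ι p.2) B ≤ dist (ι p.1) A + dist (ι p.2) A))
    (WA : ℕ)
    (hWA : WA = (Mm.filter fun p => win p = true).card) :
    (∑ v, dist (ι v) A) ≤
      (∑ v, dist (ι v) B) + ((BA.card : ℝ) - WA) * dist A B := by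
  set W := Mm.filter fun p => win p = true with hW
  set g : V → ℝ := fun v => dist (ι v) A - dist (ι v) B with hg
  have hMm : ∀ {p}, p ∈ W → p ∈ Mm := fun hp => (mem_filter.mp hp).1
  have hfst : Set.InjOn Prod.fst (W : Set (V × V)) := fun p hp q hq h =>
    hMinj p (hMm hp) q (hMm hq) (Or.inl h)
  have hsnd : Set.InjOn Prod.snd (W : Set (V × V)) := fun p hp q hq h =>
    hMinj p (hMm hp) q (hMm hq) (Or.inr h)
  have hfst_sub : W.image Prod.fst ⊆ AB :=
    image_subset_iff.mpr fun p hp => (hMmem p (hMm hp)).1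
  have hsnd_sub : W.image Prod.snd ⊆ BA :=
    image_subset_iff.mpr fun p hp => (hMmem p (hMm hp)).2
  have hpairs : ∑ v ∈ W.image Prod.fst, g v + ∑ v ∈ W.image Prod.snd, g v ≤ 0 := by
    rw [sum_image hfst, sum_image hsnd, ← sum_add_distrib]
    refine sum_nonpos fun p hp => ?_
    have := (hwin p (hMm hp)).1 (mem_filter.mp hp).2
    simp only [hg]
    linarith
  have hAB_rest : ∑ v ∈ AB \ W.image Prod.fst, g v ≤ 0 :=
    sum_nonpos fun v hv => sub_nonpos.mpr (hAB v (mem_sdiff.mp hv).1)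
  have hBA_rest : ∑ v ∈ BA \ W.image Prod.snd, g v ≤ ((BA.card : ℝ) - WA) * dist A B := by
    have hcard : ((BA \ W.image Prod.snd).card : ℝ) = BA.card - WA := by
      rw [cast_card_sdiff hsnd_sub, card_image_of_injOn hsnd, hWA]
    rw [← hcard, ← nsmul_eq_mul]
    refine sum_le_card_nsmul _ _ _ fun v _ => ?_
    have := dist_triangle (ι v) B A
    rw [dist_comm B A] at this
    simp only [hg]
    linarith
  have htotal : ∑ v, g v = ∑ v ∈ AB, g v + ∑ v ∈ BA, g v := by
    rw [← hunion, sum_union hdisj]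
  have hsplit : ∑ v, g v = ∑ v, dist (ι v) A - ∑ v, dist (ι v) B := sum_sub_distrib _ _
  have := sum_sdiff (f := g) hfst_sub
  have := sum_sdiff (f := g) hsnd_sub
  linarith
end

section
/- Let V be a finite nonempty set of voters and let A, B be two candidates, all points of a pseudometric space (M,d). Fix a tie-consistent partition (AB, BA) of V, a maximum matching M between AB and BA, and a tie-consistent deliberation assignment for M, giving W_A matched pairs won by A. Then SC(B) ≥ ((|AB| + W_A)/2)·d(A,B). -/
open Finset

/-- A sum of nonnegative terms over `s` dominates its pullback along a map injective on `t`. -/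
theorem sum_comp_le_sum_of_injOn {α β : Type*} {t : Finset α} {s : Finset β}
    {e : α → β} {g : β → ℝ} (he : ∀ a ∈ t, e a ∈ s)
    (hinj : ∀ a ∈ t, ∀ b ∈ t, e a = e b → a = b) (hg : ∀ b ∈ s, 0 ≤ g b) :
    ∑ a ∈ t, g (e a) ≤ ∑ b ∈ s, g b := by
  classical
  rw [← Finset.sum_image (f := g) (g := e) fun a ha b hb h => hinj a ha b hb h]
  exact Finset.sum_le_sum_of_subset_of_nonneg (Finset.image_subset_iff.mpr he)
    fun b hb _ => hg b hb

/-- **Lower bound on SC(B):** `SC(B) ≥ ((|AB| + W_A)/2) · d(A,B)`. -/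
theorem sc_B_lower_bound
    {M : Type*} [PseudoMetricSpace M] {V : Type*} [Fintype V] [DecidableEq V]
    [Nonempty V]
    (A B : M) (ι : V → M)
    -- tie-consistent partition (AB, BA)
    (AB BA : Finset V)
    (hdisj : Disjoint AB BA) (hunion : AB ∪ BA = Finset.univ)
    (hAB : ∀ v ∈ AB, dist (ι v) A ≤ dist (ι v) B)
    (hBA : ∀ v ∈ BA, dist (ι v) B ≤ dist (ι v) A)
    -- a maximum matching between AB and BA
    (Mm : Finset (V × V))
    (hMmem : ∀ p ∈ Mm, p.1 ∈ AB ∧ p.2 ∈ BA)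
    (hMinj : ∀ p ∈ Mm, ∀ q ∈ Mm, (p.1 = q.1 ∨ p.2 = q.2) → p = q)
    (hMmax : Mm.card = min AB.card BA.card)
    -- tie-consistent deliberation assignment (`true` = A wins)
    (win : V × V → Bool)
    (hwin : ∀ p ∈ Mm,
      (win p = true →
        dist (ι p.1) A + dist (ι p.2) A ≤ dist (ι p.1) B + dist (ι p.2) B) ∧
      (win p = false →
        dist (ι p.1) B + dist (ι p.2) B ≤ dist (ι p.1) A + dist (ι p.2) A))
    (WA : ℕ)
    (hWA : WA = (Mm.filter fun p => win p = true).card) :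
    (∑ v, dist (ι v) B) ≥ (((AB.card : ℝ) + WA) / 2) * dist A B := by
  have hsub : ∀ p ∈ Mm.filter fun p => win p = true, p ∈ Mm :=
    fun p hp => (Finset.mem_filter.mp hp).1
  have htri : ∀ x : M, dist A B ≤ dist x A + dist x B := fun x => dist_triangle_left A B x
  have hfst : ∑ p ∈ Mm.filter (fun p => win p = true), (dist (ι p.1) B - dist A B / 2) ≤
      ∑ v ∈ AB, (dist (ι v) B - dist A B / 2) :=
    sum_comp_le_sum_of_injOn (e := Prod.fst) (g := fun v => dist (ι v) B - dist A B / 2)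
      (fun p hp => (hMmem p (hsub p hp)).1)
      (fun p hp q hq h => hMinj p (hsub p hp) q (hsub q hq) (Or.inl h))
      (fun v hv => by linarith [hAB v hv, htri (ι v)])
  have hsnd : ∑ p ∈ Mm.filter (fun p => win p = true), dist (ι p.2) B ≤
      ∑ v ∈ BA, dist (ι v) B :=
    sum_comp_le_sum_of_injOn (e := Prod.snd) (g := fun v => dist (ι v) B)
      (fun p hp => (hMmem p (hsub p hp)).2)
      (fun p hp q hq h => hMinj p (hsub p hp) q (hsub q hq) (Or.inr h))
      (fun _ _ => dist_nonneg)
  have hpair : (WA : ℝ) * (dist A B / 2) ≤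
      ∑ p ∈ Mm.filter (fun p => win p = true),
        ((dist (ι p.1) B - dist A B / 2) + dist (ι p.2) B) := by
    rw [hWA, ← nsmul_eq_mul]
    refine Finset.card_nsmul_le_sum _ _ _ fun p hp => ?_
    linarith [(hwin p (hsub p hp)).1 (Finset.mem_filter.mp hp).2, htri (ι p.1), htri (ι p.2)]
  rw [Finset.sum_add_distrib] at hpair
  rw [Finset.sum_sub_distrib (s := AB), Finset.sum_const, nsmul_eq_mul] at hfst
  rw [← hunion, Finset.sum_union hdisj]
  linarith
end

section
/- Consider two candidates A = −1 and B = 1 on the real line with distance d(x,y) = |x − y|, and three voters. A deterministic rule is any function S taking as input a preference profile p : Fin 3 → Bool (p(i) = true meaning voter i reports preferring A) together with a single deliberation-outcome bit b (b = true meaning the matched pair reports favoring A) and outputting one of the two candidates. Then for every such rule S there exist voter positions x : Fin 3 → ℝ and an input (p, b) consistent with these positions — meaning: p(i) = true implies |x(i)+1| ≤ |x(i)−1| and p(i) = false implies |x(i)−1| ≤ |x(i)+1|; there exist voters i, j with p(i) = true and p(j) = false forming a maximum matching between the disagreeing voters (i.e., exactly one of the two sides of the partition has a single voter), such that b = true implies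 |x(i)+1| + |x(j)+1| ≤ |x(i)−1| + |x(j)−1| and b = false implies the reverse inequality — for which the social cost ∑_i |x(i) − c| of the candidate c = S(p,b) chosen by the rule is at least twice the social cost of the other candidate. (Theorem: any deterministic social choice rule using individual preferences and outcomes of pairwise deliberations has distortion at least 2, even with 2 candidates.) -/
open Finset

/-- **Lower bound of 2 for deterministic rules with pairwise deliberations, m = 2.**
Candidates are `A = −1` and `B = 1` on the real line, and there are three voters.
A deterministic rule `S` maps a preference profile `p : Fin 3 → Bool`
(`p i = true` means voter `i` reports preferring `A`) and a deliberation bit `b`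
(`b = true` means the matched pair reports favoring `A`) to one of the two candidates.
For every such rule there is a consistent instance on which the chosen candidate's
social cost is at least twice that of the other candidate. -/
theorem pairwise_deliberation_lower_bound_two
    (S : (Fin 3 → Bool) → Bool → ℝ)
    (hS : ∀ p b, S p b = -1 ∨ S p b = 1) :
    ∃ (x : Fin 3 → ℝ) (p : Fin 3 → Bool) (b : Bool) (i j : Fin 3),
      -- individual preferences are consistent with the positions
      (∀ k, p k = true → |x k + 1| ≤ |x k - 1|) ∧
      (∀ k, p k = false → |x k - 1| ≤ |x k + 1|) ∧
      -- i and j disagree and form a maximum matching between the disagreeing voters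
      p i = true ∧ p j = false ∧
      ((Finset.univ.filter fun k => p k = true).card = 1 ∨
        (Finset.univ.filter fun k => p k = false).card = 1) ∧
      -- the deliberation outcome is consistent with the positions
      (b = true → |x i + 1| + |x j + 1| ≤ |x i - 1| + |x j - 1|) ∧
      (b = false → |x i - 1| + |x j - 1| ≤ |x i + 1| + |x j + 1|) ∧
      -- the candidate chosen by the rule has social cost at least twice the other's
      (∑ k, |x k - S p b|) ≥ 2 * ∑ k, |x k - (-(S p b))| := by
  rcases hS ![true, false, false] true with h | h
  · refine ⟨![-1, 1, 1], ![true, false, false], true, 0, 1, ?_, ?_, rfl, rfl, Or.inl (by decide),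
      ?_, by simp, ?_⟩
    · simp [Fin.forall_fin_succ]
    · simp [Fin.forall_fin_succ]
    · norm_num
    · rw [h]
      norm_num [Fin.sum_univ_succ]
  · refine ⟨![-1, 0, 0], ![true, false, false], true, 0, 1, ?_, ?_, rfl, rfl, Or.inl (by decide),
      ?_, by simp, ?_⟩
    · simp [Fin.forall_fin_succ]
    · simp [Fin.forall_fin_succ]
    · norm_num
    · rw [h]
      norm_num [Fin.sum_univ_succ]
end

section
/- Let V be a finite nonempty set and let X, Y, Z : V → ℝ. The following are equivalent: (i) there exist a pseudometric space (M,d), points a, b, c ∈ M, and a map ι : V → M such that for every v ∈ V one has d(ι(v), c) = Z(v), d(ι(v), c) − d(ι(v), a) = X(v), and d(ι(v), b) − d(ι(v), c) = Y(v); (ii) for every v ∈ V, Z(v) ≥ max{(‖X‖∞ + X(v))/2, (‖Y‖∞ − Y(v))/2, (‖X+Y‖∞ + X(v) − Y(v))/2}. -/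
open Finset

universe u

/-- **Metric realizability (Lemma `Z_min`).** Given `X, Y, Z : V → ℝ` on a finite
nonempty set of voters, there is a pseudometric space with points `a, b, c` and an
embedding `ι` of the voters realizing `Z(v) = d(ι v, c)`,
`X(v) = d(ι v, c) − d(ι v, a)` and `Y(v) = d(ι v, b) − d(ι v, c)` if and only if
`Z(v) ≥ max{(‖X‖∞ + X(v))/2, (‖Y‖∞ − Y(v))/2, (‖X+Y‖∞ + X(v) − Y(v))/2}`
for every voter `v`. -/
theorem metric_realizability_iff_Zmin
    {V : Type u} [Fintype V] [Nonempty V] (X Y Z : V → ℝ) :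
    (∃ (M : Type u) (d : M → M → ℝ),
      (∀ p, d p p = 0) ∧ (∀ p q, 0 ≤ d p q) ∧ (∀ p q, d p q = d q p) ∧
      (∀ p q r, d p r ≤ d p q + d q r) ∧
      ∃ (a b c : M) (ι : V → M),
        ∀ v, d (ι v) c = Z v ∧ d (ι v) c - d (ι v) a = X v ∧
          d (ι v) b - d (ι v) c = Y v) ↔
    (∀ v, Z v ≥
      max (((Finset.univ.sup' Finset.univ_nonempty fun u => |X u|) + X v) / 2)
        (max (((Finset.univ.sup' Finset.univ_nonempty fun u => |Y u|) - Y v) / 2)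
          (((Finset.univ.sup' Finset.univ_nonempty fun u => |X u + Y u|)
            + X v - Y v) / 2))) := by
  simp only [ge_iff_le, max_le_iff]
  constructor
  · rintro ⟨M, d, -, -, hsymm, htri, a, b, c, ι, h⟩ v
    obtain ⟨hZv, hXv, hYv⟩ := h v
    have hX : (univ.sup' univ_nonempty fun u => |X u|) ≤ d a c :=
      sup'_le _ _ fun u _ => by
        obtain ⟨hZ, hX, hY⟩ := h u
        rw [abs_le]
        constructor <;>
          linarith [htri (ι u) a c, htri (ι u) c a, hsymm a c]
    have hY : (univ.sup' univ_nonempty fun u => |Y u|) ≤ d b c :=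
      sup'_le _ _ fun u _ => by
        obtain ⟨hZ, hX, hY⟩ := h u
        rw [abs_le]
        constructor <;>
          linarith [htri (ι u) b c, htri (ι u) c b, hsymm b c]
    have hXY : (univ.sup' univ_nonempty fun u => |X u + Y u|) ≤ d a b :=
      sup'_le _ _ fun u _ => by
        obtain ⟨hZ, hX, hY⟩ := h u
        rw [abs_le]
        constructor <;>
          linarith [htri (ι u) a b, htri (ι u) b a, hsymm a b]
    refine ⟨?_, ?_, ?_⟩
    · linarith [htri a (ι v) c, hsymm a (ι v)]
    · linarith [htri b (ι v) c, hsymm b (ι v)]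
    · linarith [htri a (ι v) b, hsymm a (ι v)]
  · intro h
    have hX : ∀ v, |X v| ≤ univ.sup' univ_nonempty fun u => |X u| :=
      fun v => le_sup' (fun u => |X u|) (mem_univ v)
    have hY : ∀ v, |Y v| ≤ univ.sup' univ_nonempty fun u => |Y u| :=
      fun v => le_sup' (fun u => |Y u|) (mem_univ v)
    have hXY : ∀ v, |X v + Y v| ≤ univ.sup' univ_nonempty fun u => |X u + Y u| :=
      fun v => le_sup' (fun u => |X u + Y u|) (mem_univ v)
    generalize (univ.sup' univ_nonempty fun u => |X u|) = p at h hX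
    generalize (univ.sup' univ_nonempty fun u => |Y u|) = q at h hY
    generalize (univ.sup' univ_nonempty fun u => |X u + Y u|) = r at h hXY
    -- Each point is represented by its prescribed distances to `a`, `b`, `c`, in the sup metric.
    refine ⟨ULift.{u} (ℝ × ℝ × ℝ), fun x y => dist x y, dist_self, fun _ _ => dist_nonneg,
      dist_comm, dist_triangle, ⟨0, r, p⟩, ⟨r, 0, q⟩, ⟨p, q, 0⟩,
      fun v => ⟨Z v - X v, Z v + Y v, Z v⟩, fun v => ?_⟩
    obtain ⟨hp, hq, hr⟩ := h v
    have hXv := abs_le.1 (hX v)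
    have hYv := abs_le.1 (hY v)
    have hXYv := abs_le.1 (hXY v)
    have dist_c : max |Z v - X v - p| (max |Z v + Y v - q| |Z v|) = Z v := by
      rw [abs_of_nonneg (by linarith : 0 ≤ Z v), max_eq_right]
      · exact max_eq_right (abs_le.2 ⟨by linarith, by linarith⟩)
      · exact le_max_of_le_right (abs_le.2 ⟨by linarith, by linarith⟩)
    have dist_a : max |Z v - X v| (max |Z v + Y v - r| |Z v - p|) = Z v - X v := by
      rw [abs_of_nonneg (by linarith : 0 ≤ Z v - X v)]
      exact max_eq_left (max_le (abs_le.2 ⟨by linarith, by linarith⟩)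
        (abs_le.2 ⟨by linarith, by linarith⟩))
    have dist_b : max |Z v - X v - r| (max |Z v + Y v| |Z v - q|) = Z v + Y v := by
      rw [abs_of_nonneg (by linarith : 0 ≤ Z v + Y v),
        max_eq_left (abs_le.2 ⟨by linarith, by linarith⟩ : |Z v - q| ≤ Z v + Y v)]
      exact max_eq_right (abs_le.2 ⟨by linarith, by linarith⟩)
    simp only [ULift.dist_eq, Prod.dist_eq, Real.dist_eq, sub_zero, dist_a, dist_b, dist_c]
    exact ⟨trivial, by ring, by ring⟩
end

section
/- For all real numbers a, b, c, the function h : ℝ × ℝ → ℝ given by h(x,y) = max{a + x, b − y, c + x − y} is supermodular: for all x₁ ≤ x₂ and y₁ ≤ y₂, h(x₁,y₁) + h(x₂,y₂) ≥ h(x₁,y₂) + h(x₂,y₁). -/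
/-- The function `h(x,y) = max{a + x, b − y, c + x − y}` is supermodular. -/
theorem max_three_planes_supermodular (a b c : ℝ)
    (x₁ x₂ y₁ y₂ : ℝ) (hx : x₁ ≤ x₂) (hy : y₁ ≤ y₂) :
    max (a + x₁) (max (b - y₁) (c + x₁ - y₁)) +
      max (a + x₂) (max (b - y₂) (c + x₂ - y₂)) ≥
    max (a + x₁) (max (b - y₂) (c + x₁ - y₂)) +
      max (a + x₂) (max (b - y₁) (c + x₂ - y₁)) := by
  have bounds (x y : ℝ) :
      a + x ≤ max (a + x) (max (b - y) (c + x - y)) ∧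
      b - y ≤ max (a + x) (max (b - y) (c + x - y)) ∧
      c + x - y ≤ max (a + x) (max (b - y) (c + x - y)) := by
    simp
  obtain ⟨hA₁, hB₁, hC₁⟩ := bounds x₁ y₁
  obtain ⟨hA₂, hB₂, hC₂⟩ := bounds x₂ y₂
  rcases max_choice (a + x₁) (max (b - y₂) (c + x₁ - y₂)) with h | h <;>
  rcases max_choice (b - y₂) (c + x₁ - y₂) with h' | h' <;>
  rcases max_choice (a + x₂) (max (b - y₁) (c + x₂ - y₁)) with k | k <;>
  rcases max_choice (b - y₁) (c + x₂ - y₁) with k' | k' <;>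
  linarith
end

section
/- Let n ≥ 1, let x, y : Fin n → ℝ, and let R > 0. For a permutation σ of Fin n define Φ(σ) = ∑_i x(i) + (R+1)·∑_i y(i) + R·∑_i max{(Mx + x(i))/2, (My − y(σ(i)))/2, (Ms(σ) + x(i) − y(σ(i)))/2}, where Mx = max_i |x(i)|, My = max_i |y(i)|, and Ms(σ) = max_i |x(i) + y(σ(i))|. Then there exists a permutation σ* attaining the minimum of Φ over all permutations of Fin n such that the induced pairing is counter-monotone: for all i, j, (x(i) − x(j))·(y(σ*(i)) − y(σ*(j))) ≤ 0. (Lemma: counter-monotone coupling of X and Y minimizes the distortion objective Φ_R.) -/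
open Finset

/-- The distortion objective `Φ_R` associated to a coupling (permutation) `σ`
pairing `x i` with `y (σ i)`:
`Φ(σ) = ∑ x + (R+1)·∑ y + R·∑ᵢ max{(Mx + xᵢ)/2, (My − y(σ i))/2, (Ms(σ) + xᵢ − y(σ i))/2}`,
where `Mx = maxᵢ |x i|`, `My = maxᵢ |y i|`, and `Ms(σ) = maxᵢ |x i + y (σ i)|`. -/
noncomputable def Phi (n : ℕ) (x y : Fin n → ℝ) (R : ℝ) (σ : Equiv.Perm (Fin n)) : ℝ :=
  (∑ i, x i) + (R + 1) * (∑ i, y i) +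
    R * ∑ i,
      max (((⨆ k, |x k|) + x i) / 2)
        (max (((⨆ k, |y k|) - y (σ i)) / 2)
          (((⨆ k, |x k + y (σ k)|) + x i - y (σ i)) / 2))

/-- Changing a permutation by a transposition changes a pairing sum only at the two swapped
indices. -/
theorem sum_mul_swap_sub_sum {ι : Type*} [Fintype ι] [DecidableEq ι] (F : ι → ι → ℝ)
    (σ : Equiv.Perm ι) {i j : ι} (hij : i ≠ j) :
    ∑ k, F k ((σ * Equiv.swap i j) k) - ∑ k, F k (σ k) =
      (F i (σ j) + F j (σ i)) - (F i (σ i) + F j (σ j)) := by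
  rw [← Finset.sum_sub_distrib, Finset.sum_eq_add i j hij]
  · simp
    ring
  · rintro k - ⟨hki, hkj⟩
    simp [Equiv.swap_apply_of_ne_of_ne hki hkj]
  · simp
  · simp

/-- For fixed `A B C` the summand of `Phi` prefers counter-monotone pairs. -/
theorem max_cross_add_le (A B C : ℝ) {a a' b b' : ℝ} (ha : a' ≤ a) (hb : b' ≤ b) :
    max ((A + a) / 2) (max ((B - b') / 2) ((C + a - b') / 2)) +
        max ((A + a') / 2) (max ((B - b) / 2) ((C + a' - b) / 2)) ≤
      max ((A + a) / 2) (max ((B - b) / 2) ((C + a - b) / 2)) +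
        max ((A + a') / 2) (max ((B - b') / 2) ((C + a' - b') / 2)) := by
  grind

/-- Uncrossing a pair that is ordered the same way by `x` and by `y ∘ σ` does not increase
`maxₖ |x k + y (σ k)|`. -/
theorem iSup_abs_add_mul_swap_le {ι : Type*} [Finite ι] [DecidableEq ι] (x y : ι → ℝ)
    (σ : Equiv.Perm ι) {i j : ι} (hx : x j ≤ x i) (hy : y (σ j) ≤ y (σ i)) :
    ⨆ k, |x k + y ((σ * Equiv.swap i j) k)| ≤ ⨆ k, |x k + y (σ k)| := by
  have : Nonempty ι := ⟨i⟩
  have hle (k : ι) : |x k + y (σ k)| ≤ ⨆ k, |x k + y (σ k)| :=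
    le_ciSup (f := fun k => |x k + y (σ k)|) (Set.finite_range _).bddAbove k
  have hi := abs_le.mp (hle i)
  have hj := abs_le.mp (hle j)
  refine ciSup_le fun k => ?_
  by_cases hki : k = i
  · subst hki
    rw [Equiv.Perm.mul_apply, Equiv.swap_apply_left, abs_le]
    constructor <;> linarith
  by_cases hkj : k = j
  · subst hkj
    rw [Equiv.Perm.mul_apply, Equiv.swap_apply_right, abs_le]
    constructor <;> linarith
  rw [Equiv.Perm.mul_apply, Equiv.swap_apply_of_ne_of_ne hki hkj]
  exact hle k

/-- Uncrossing a pair that is ordered the same way by `x` and by `y ∘ σ` does not increase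
`Phi`. -/
theorem Phi_mul_swap_le {n : ℕ} (x y : Fin n → ℝ) {R : ℝ} (hR : 0 ≤ R)
    (σ : Equiv.Perm (Fin n)) {i j : Fin n} (hij : i ≠ j) (hx : x j ≤ x i)
    (hy : y (σ j) ≤ y (σ i)) : Phi n x y R (σ * Equiv.swap i j) ≤ Phi n x y R σ := by
  unfold Phi
  refine add_le_add le_rfl (mul_le_mul_of_nonneg_left ?_ hR)
  have hsum := sum_mul_swap_sub_sum
    (fun k l => max (((⨆ k, |x k|) + x k) / 2)
      (max (((⨆ k, |y k|) - y l) / 2) (((⨆ k, |x k + y (σ k)|) + x k - y l) / 2))) σ hij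
  have hcross := max_cross_add_le (⨆ k, |x k|) (⨆ k, |y k|) (⨆ k, |x k + y (σ k)|) hx hy
  refine le_trans (Finset.sum_le_sum fun k _ => ?_) (sub_nonpos.mp (hsum.trans_le ?_))
  · have hs := iSup_abs_add_mul_swap_le x y σ hx hy
    gcongr
  · exact sub_nonpos.mpr hcross

/-- **Counter-monotone coupling minimizes the distortion objective.**
There is a permutation attaining the minimum of `Φ_R` over all permutations whose
induced pairing is counter-monotone. -/
theorem counter_monotone_coupling_minimizes
    (n : ℕ) (hn : 1 ≤ n) (x y : Fin n → ℝ) (R : ℝ) (hR : 0 < R) :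
    ∃ σs : Equiv.Perm (Fin n),
      (∀ σ : Equiv.Perm (Fin n), Phi n x y R σs ≤ Phi n x y R σ) ∧
      ∀ i j, (x i - x j) * (y (σs i) - y (σs j)) ≤ 0 := by
  obtain ⟨σ, -, hσ⟩ := Finset.exists_min_image (univ : Finset (Equiv.Perm (Fin n)))
    (fun σ => toLex (Phi n x y R σ, ∑ k, x k * y (σ k))) univ_nonempty
  simp only [mem_univ, true_implies, Prod.Lex.toLex_le_toLex] at hσ
  have ordered (i j : Fin n) (hx : x j < x i) : y (σ i) ≤ y (σ j) := by
    by_contra! hy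
    have hij : i ≠ j := by
      rintro rfl
      exact lt_irrefl _ hx
    have hsum := sum_mul_swap_sub_sum (fun k l => x k * y l) σ hij
    rcases hσ (σ * Equiv.swap i j) with h | ⟨-, h⟩
    · exact h.not_ge (Phi_mul_swap_le x y hR.le σ hij hx.le hy.le)
    · nlinarith [mul_pos (sub_pos.mpr hx) (sub_pos.mpr hy)]
  refine ⟨σ, fun τ => (hσ τ).elim le_of_lt fun h => h.1.le, fun i j => ?_⟩
  rcases lt_trichotomy (x i) (x j) with h | h | h
  · exact mul_nonpos_of_nonpos_of_nonneg (by linarith) (by linarith [ordered j i h])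
  · simp [h]
  · exact mul_nonpos_of_nonneg_of_nonpos (by linarith) (by linarith [ordered i j h])
end

section
/- Let V be a finite nonempty set, let X, Y : V → ℝ, and let u ≠ v be two elements of V. Define X' : V → ℝ by X'(u) = X'(v) = (X(u) + X(v))/2 and X'(w) = X(w) for w ∉ {u,v}, and define Y' analogously from Y. Then ∑_{w∈V} Z_min(X',Y')(w) ≤ ∑_{w∈V} Z_min(X,Y)(w). Consequently, since ∑X' = ∑X and ∑Y' = ∑Y, for every R ≥ 0 the objective ∑X + (R+1)·∑Y + R·∑Z_min does not increase when the two voters are replaced by two copies of their average. (Lemma: compacting an interval.) -/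
open Finset

/-- `Z_min(X,Y)(v) = max{(‖X‖∞ + X v)/2, (‖Y‖∞ − Y v)/2, (‖X+Y‖∞ + X v − Y v)/2}`,
where `‖F‖∞ = max_{v} |F v|` over the finite nonempty set `V`. -/
noncomputable def Zmin {V : Type*} [Fintype V] [Nonempty V]
    (X Y : V → ℝ) (v : V) : ℝ :=
  max (((⨆ u, |X u|) + X v) / 2)
    (max (((⨆ u, |Y u|) - Y v) / 2)
      (((⨆ u, |X u + Y u|) + X v - Y v) / 2))

lemma iSup_abs_average_perm_le {V : Type*} [Fintype V] [Nonempty V]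
    (F : V → ℝ) (σ : Equiv.Perm V) :
    (⨆ w, |(F w + F (σ w)) / 2|) ≤ ⨆ w, |F w| := by
  have hF (w : V) : |F w| ≤ ⨆ w, |F w| :=
    le_ciSup (f := fun w => |F w|) (Set.finite_range _).bddAbove w
  refine ciSup_le fun w => ?_
  rw [abs_div, abs_two]
  linarith [abs_add_le (F w) (F (σ w)), hF w, hF (σ w)]

lemma Zmin_average_perm_le {V : Type*} [Fintype V] [Nonempty V]
    (X Y : V → ℝ) (σ : Equiv.Perm V) (w : V) :
    Zmin (fun w => (X w + X (σ w)) / 2) (fun w => (Y w + Y (σ w)) / 2) w ≤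
      (Zmin X Y w + Zmin X Y (σ w)) / 2 := by
  have hX := iSup_abs_average_perm_le X σ
  have hY := iSup_abs_average_perm_le Y σ
  have hXY := iSup_abs_average_perm_le (fun w => X w + Y w) σ
  have hsum (t : V) : (X t + X (σ t)) / 2 + (Y t + Y (σ t)) / 2 =
      (X t + Y t + (X (σ t) + Y (σ t))) / 2 := by ring
  have hZ (t : V) : ((⨆ s, |X s|) + X t) / 2 ≤ Zmin X Y t ∧
      ((⨆ s, |Y s|) - Y t) / 2 ≤ Zmin X Y t ∧
      ((⨆ s, |X s + Y s|) + X t - Y t) / 2 ≤ Zmin X Y t := by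
    simp [Zmin]
  obtain ⟨h₁, h₂, h₃⟩ := hZ w
  obtain ⟨k₁, k₂, k₃⟩ := hZ (σ w)
  rw [Zmin]
  simp only [hsum]
  refine max_le ?_ (max_le ?_ ?_) <;> linarith

lemma sum_average_perm {V : Type*} [Fintype V] (F : V → ℝ) (σ : Equiv.Perm V) :
    ∑ w, (F w + F (σ w)) / 2 = ∑ w, F w := by
  rw [← Finset.sum_div, Finset.sum_add_distrib, Equiv.sum_comp σ F]
  ring

lemma average_swap_apply {V : Type*} [DecidableEq V] (F : V → ℝ) (u v w : V) :
    (if w = u ∨ w = v then (F u + F v) / 2 else F w) =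
      (F w + F (Equiv.swap u v w)) / 2 := by
  by_cases hu : w = u
  · simp [hu]
  by_cases hv : w = v
  · simp [hv, add_comm]
  simp [hu, hv, Equiv.swap_apply_of_ne_of_ne]

/-- **Compacting an interval.** Replacing two voters `u ≠ v` by two copies of
their average does not increase `∑ Z_min`, and hence, since `∑ X` and `∑ Y` are
preserved, it does not increase the objective
`∑X + (R+1)·∑Y + R·∑Z_min` for any `R ≥ 0`. -/
theorem compacting_interval
    {V : Type*} [Fintype V] [Nonempty V] [DecidableEq V]
    (X Y : V → ℝ) (u v : V) (huv : u ≠ v)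
    (X' Y' : V → ℝ)
    (hX' : ∀ w, X' w = if w = u ∨ w = v then (X u + X v) / 2 else X w)
    (hY' : ∀ w, Y' w = if w = u ∨ w = v then (Y u + Y v) / 2 else Y w) :
    (∑ w, Zmin X' Y' w) ≤ (∑ w, Zmin X Y w) ∧
    ∀ R : ℝ, 0 ≤ R →
      (∑ w, X' w) + (R + 1) * (∑ w, Y' w) + R * (∑ w, Zmin X' Y' w) ≤
        (∑ w, X w) + (R + 1) * (∑ w, Y w) + R * (∑ w, Zmin X Y w) := by
  obtain rfl : X' = fun w => (X w + X (Equiv.swap u v w)) / 2 :=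
    funext fun w => (hX' w).trans (average_swap_apply X u v w)
  obtain rfl : Y' = fun w => (Y w + Y (Equiv.swap u v w)) / 2 :=
    funext fun w => (hY' w).trans (average_swap_apply Y u v w)
  have hZ := (Finset.sum_le_sum fun w _ =>
    Zmin_average_perm_le X Y (Equiv.swap u v) w).trans_eq
      (sum_average_perm (Zmin X Y) (Equiv.swap u v))
  refine ⟨hZ, fun R hR => ?_⟩
  rw [sum_average_perm, sum_average_perm]
  gcongr
end

section
/- Let λ* = (3−√3)/2 and w* = √3 − 1. (i) If a ∈ [0,1] and W is a real number with 0 ≤ W ≤ min(a, 1−a) satisfying a + w*·W = (1−λ*)·(1 + w*·min(a, 1−a)), then 1/4 ≤ a ≤ 1/2. (ii) If b ∈ [0,1] and W' is a real number with 0 ≤ W' ≤ min(b, 1−b) satisfying b + w*·W' = λ*·(1 + w*·min(b, 1−b)), then 1/2 ≤ b ≤ 3/4. (Lemma: when f(AC;w*) = 1−λ* one has 1/4 ≤ |AC| ≤ 1/2, and when f(CB;w*) = λ* one has 1/2 ≤ |CB| ≤ 3/4, where voter masses are normalized to total 1.) -/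
/-- If the weighted fraction won by a candidate supported by mass `a` equals
`1 - λ* = (√3 - 1) / 2`, then `a` lies between `1/4` and `1/2`. -/
lemma mem_quarter_half_of_weighted_fraction_eq {a W : ℝ} (hW : 0 ≤ W) (hWm : W ≤ min a (1 - a))
    (h : a + (Real.sqrt 3 - 1) * W =
      (1 - (3 - Real.sqrt 3) / 2) * (1 + (Real.sqrt 3 - 1) * min a (1 - a))) :
    1 / 4 ≤ a ∧ a ≤ 1 / 2 := by
  obtain ⟨w, hw⟩ : ∃ w, w = Real.sqrt 3 - 1 := ⟨_, rfl⟩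
  have hs : Real.sqrt 3 = w + 1 := by linarith
  have hsq : (w + 1) ^ 2 = 3 := hs ▸ Real.sq_sqrt (by norm_num)
  have hw0 : 0 < w := by
    rw [hw, sub_pos]
    exact Real.lt_sqrt_of_sq_lt (by norm_num)
  rw [hs] at h
  rcases le_total a (1 / 2) with ha | ha
  · rw [min_eq_left (by linarith)] at h hWm
    have hsum : a + W = 1 / 2 :=
      mul_left_cancel₀ hw0.ne' (by linear_combination h + a / 2 * hsq)
    constructor <;> linarith
  · rw [min_eq_right (by linarith)] at h
    have hprod : (2 - w) * (a - 1 / 2) + w * W = 0 := by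
      linear_combination h + (1 - a) / 2 * hsq
    have hw2 : w < 2 := by nlinarith
    have hle : a ≤ 1 / 2 := by nlinarith [mul_nonneg hw0.le hW]
    constructor <;> linarith

/-- **Permissible sizes under the tight `f` constraints.** With
`λ* = (3−√3)/2` and `w* = √3−1` and voter mass normalized to 1:
(i) if `f(AC;w*) = 1−λ*`, i.e. `a + w*·W = (1−λ*)·(1 + w*·min(a,1−a))` with
`0 ≤ W ≤ min(a,1−a)`, then `1/4 ≤ a ≤ 1/2`;
(ii) if `f(CB;w*) = λ*`, then `1/2 ≤ b ≤ 3/4`. -/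
theorem permissible_sizes_AC_CB :
    (∀ a W : ℝ, 0 ≤ a → a ≤ 1 → 0 ≤ W → W ≤ min a (1 - a) →
      a + (Real.sqrt 3 - 1) * W =
        (1 - (3 - Real.sqrt 3) / 2) * (1 + (Real.sqrt 3 - 1) * min a (1 - a)) →
      1 / 4 ≤ a ∧ a ≤ 1 / 2) ∧
    (∀ b W' : ℝ, 0 ≤ b → b ≤ 1 → 0 ≤ W' → W' ≤ min b (1 - b) →
      b + (Real.sqrt 3 - 1) * W' =
        ((3 - Real.sqrt 3) / 2) * (1 + (Real.sqrt 3 - 1) * min b (1 - b)) →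
      1 / 2 ≤ b ∧ b ≤ 3 / 4) := by
  refine ⟨fun a W _ _ hW hWm h => mem_quarter_half_of_weighted_fraction_eq hW hWm h,
    fun b W' _ _ hW hWm h => ?_⟩
  have hmin : min (1 - b) (1 - (1 - b)) = min b (1 - b) := by
    rw [sub_sub_cancel, min_comm]
  have key := mem_quarter_half_of_weighted_fraction_eq (a := 1 - b) (W := min b (1 - b) - W')
    (by linarith) (by rw [hmin]; linarith) (by rw [hmin]; linear_combination -h)
  constructor <;> linarith [key.1, key.2]
end
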